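/- Every ternary word of length 8 contains an abelian square (a nonempty factor uv with u and v abelian equivalent). -/

import Mathlib

/-- Abelian equivalence: same number of occurrences of each letter. -/
def abelEq {α : Type*} [DecidableEq α] (u v : List α) : Prop :=
  ∀ a, u.count a = v.count a

/-- An abelian square: a nonempty word of the form `u₁ u₂` with `u₁` and `u₂`
abelian equivalent. -/
def IsAbSquare {α : Type*} [DecidableEq α] (v : List α) : Prop :=
  v ≠ [] ∧ ∃ u₁ u₂ : List α, v = u₁ ++ u₂ ∧ abelEq u₁ u₂

/-- `l` starts with an abelian square of half-length `k`. -/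
def preSqAt (l : List (Fin 3)) (k : ℕ) : Bool :=
  decide (1 ≤ k ∧ 1 ≤ l.length) &&
    decide (∀ a : Fin 3, (l.take k).count a = ((l.drop k).take k).count a)

/-- `l` starts with an abelian square of half-length at most 4. -/
def preSq (l : List (Fin 3)) : Bool :=
  preSqAt l 1 || preSqAt l 2 || preSqAt l 3 || preSqAt l 4

/-- Backtracking search: every extension of `l` by `n` letters on the left has an
abelian square. -/
def searchSq : ℕ → List (Fin 3) → Bool
  | 0, l => preSq l
  | n + 1, l => preSq l ||
      (searchSq n (0 :: l) && searchSq n (1 :: l) && searchSq n (2 :: l))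

theorem preSqAt_sound (l : List (Fin 3)) (k : ℕ) (h : preSqAt l k = true) :
    ∃ v : List (Fin 3), v <:+: l ∧ IsAbSquare v := by
  simp only [preSqAt, Bool.and_eq_true, decide_eq_true_eq] at h
  obtain ⟨⟨hk, hl⟩, hc⟩ := h
  refine ⟨l.take k ++ (l.drop k).take k, ?_, ?_, _, _, rfl, hc⟩
  · refine ⟨[], (l.drop k).drop k, ?_⟩
    rw [List.nil_append, List.append_assoc, List.take_append_drop, List.take_append_drop]
  · intro h0
    have := congrArg List.length h0
    simp only [List.length_append, List.length_take, List.length_nil] at this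
    omega

theorem preSq_sound (l : List (Fin 3)) (h : preSq l = true) :
    ∃ v : List (Fin 3), v <:+: l ∧ IsAbSquare v := by
  simp only [preSq, Bool.or_eq_true] at h
  rcases h with ((h | h) | h) | h <;> exact preSqAt_sound l _ h

theorem searchSq_sound (n : ℕ) : ∀ (l : List (Fin 3)), searchSq n l = true →
    ∀ u : List (Fin 3), u.length = n →
      ∃ v : List (Fin 3), v <:+: u.reverse ++ l ∧ IsAbSquare v := by
  have base : ∀ l u : List (Fin 3), preSq l = true →
      ∃ v : List (Fin 3), v <:+: u.reverse ++ l ∧ IsAbSquare v := by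
    intro l u h
    obtain ⟨v, hv, hs⟩ := preSq_sound l h
    exact ⟨v, hv.trans (List.suffix_append _ _).isInfix, hs⟩
  induction n with
  | zero => intro l h u _; exact base l u h
  | succ n ih =>
    intro l h u hu
    simp only [searchSq, Bool.or_eq_true, Bool.and_eq_true] at h
    rcases h with h | ⟨⟨h0, h1⟩, h2⟩
    · exact base l u h
    · match u, hu with
      | a :: u, hu =>
        have hu' : u.length = n := by simpa using hu
        have ha : searchSq n (a :: l) = true := by
          fin_cases a
          · exact h0
          · exact h1
          · exact h2
        simpa using ih (a :: l) ha u hu'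

/-- Every ternary word of length 8 contains an abelian square. -/
theorem stmt5 (w : List (Fin 3)) (hw : w.length = 8) :
    ∃ v : List (Fin 3), v <:+: w ∧ IsAbSquare v := by
  have hs : searchSq 8 [] = true := by decide +kernel
  simpa using searchSq_sound 8 [] hs w.reverse (by simpa using hw)
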